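/- (Theorem 2) Let ρ_AB be a density matrix on ℂ^{d_A} ⊗ ℂ^{d_B} with d_A, d_B ≥ 2, global purity P_AB = Tr[ρ_AB²], d_AB = d_A d_B, and let M_A, M_B be Hermitian matrices on ℂ^{d_A}, ℂ^{d_B} with nonzero operator norm. Let C(M_A, M_B) = Tr[ρ_AB (M_A ⊗ M_B)] − Tr[ρ_AB (M_A ⊗ I)]·Tr[ρ_AB (I ⊗ M_B)]. Then the squashed entanglement satisfies E_sq(ρ_AB) ≥ max{ C(M_A, M_B)² / (4 ‖M_A‖² ‖M_B‖²) − U(P_AB, d_AB)/2, 0 }. -/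

import Mathlib

open scoped Kronecker ComplexOrder

/-- Von Neumann entropy (natural logarithm) of a matrix, via its eigenvalues
(`0` if the matrix is not Hermitian; `Real.log 0 = 0` handles zero eigenvalues). -/
noncomputable def vN {n : Type*} [Fintype n] [DecidableEq n] (ρ : Matrix n n ℂ) : ℝ :=
  if h : ρ.IsHermitian then -∑ i, h.eigenvalues i * Real.log (h.eigenvalues i) else 0

/-- Partial trace over the second tensor factor. -/
noncomputable def ptraceB {A B : Type*} [Fintype B] (ρ : Matrix (A × B) (A × B) ℂ) :
    Matrix A A ℂ := Matrix.of fun a a' => ∑ b, ρ (a, b) (a', b)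

/-- Partial trace over the first tensor factor. -/
noncomputable def ptraceA {A B : Type*} [Fintype A] (ρ : Matrix (A × B) (A × B) ℂ) :
    Matrix B B ℂ := Matrix.of fun b b' => ∑ a, ρ (a, b) (a, b')

/-- Partial trace over the third factor of a tripartite system `A × B × C`. -/
noncomputable def ptraceC3 {A B C : Type*} [Fintype C] (ρ : Matrix (A × B × C) (A × B × C) ℂ) :
    Matrix (A × B) (A × B) ℂ := Matrix.of fun x y => ∑ c, ρ (x.1, x.2, c) (y.1, y.2, c)

/-- Partial trace over the second factor of a tripartite system `A × B × C`. -/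
noncomputable def ptraceB3 {A B C : Type*} [Fintype B] (ρ : Matrix (A × B × C) (A × B × C) ℂ) :
    Matrix (A × C) (A × C) ℂ := Matrix.of fun x y => ∑ b, ρ (x.1, b, x.2) (y.1, b, y.2)

/-- Conditional mutual information `I(A:B|C) = S(ρ_AC) + S(ρ_BC) − S(ρ_ABC) − S(ρ_C)`. -/
noncomputable def condMutualInfo {A B C : Type*} [Fintype A] [DecidableEq A] [Fintype B]
    [DecidableEq B] [Fintype C] [DecidableEq C]
    (ρ : Matrix (A × B × C) (A × B × C) ℂ) : ℝ :=
  vN (ptraceB3 ρ) + vN (ptraceA ρ) - vN ρ - vN (ptraceA (ptraceA ρ))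

/-- Squashed entanglement: `(1/2) inf I(A:B|C)` over all finite-dimensional extensions
`ρ_ABC` (density matrices with `Tr_C ρ_ABC = ρ_AB`). -/
noncomputable def Esq {A B : Type*} [Fintype A] [DecidableEq A] [Fintype B] [DecidableEq B]
    (ρAB : Matrix (A × B) (A × B) ℂ) : ℝ :=
  sInf { x : ℝ | ∃ (dC : ℕ), 1 ≤ dC ∧
    ∃ ρ : Matrix (A × B × Fin dC) (A × B × Fin dC) ℂ,
      ρ.PosSemidef ∧ ρ.trace = 1 ∧ ptraceC3 ρ = ρAB ∧ x = (1 / 2) * condMutualInfo ρ }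

/-- Upper bound `U(P,d)` on the entropy at fixed purity `P` in dimension `d`:
`U(P,d) = −[(1 − λ) ln((1 − λ)/(d − 1)) + λ ln λ]` with `λ = 1/d + √((1 − 1/d)(P − 1/d))`. -/
noncomputable def Uent (P : ℝ) (d : ℕ) : ℝ :=
  let lam : ℝ := 1 / (d : ℝ) + Real.sqrt ((1 - 1 / (d : ℝ)) * (P - 1 / (d : ℝ)));
  -((1 - lam) * Real.log ((1 - lam) / ((d : ℝ) - 1)) + lam * Real.log lam)

/-- Operator (ℓ² → ℓ²) norm of a matrix. -/
noncomputable def opNorm {n : Type*} [Fintype n] [DecidableEq n] (M : Matrix n n ℂ) : ℝ :=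
  ‖Matrix.toEuclideanCLM (𝕜 := ℂ) M‖

set_option linter.unusedSectionVars false

namespace Squashed

open Matrix Filter Topology

section

variable {m n : Type*} [Fintype m] [DecidableEq m] [Fintype n] [DecidableEq n]

/-- `U` unitarily diagonalizes `ρ`, with eigenvalues `p`. -/
structure IsSpecDecomp (ρ U : Matrix n n ℂ) (p : n → ℝ) : Prop where
  unitary : Uᴴ * U = 1
  eq : ρ = U * diagonal (fun i => (p i : ℂ)) * Uᴴ

namespace IsSpecDecomp

variable {ρ σ U V : Matrix n n ℂ} {p q : n → ℝ}

lemma unitary' (h : IsSpecDecomp ρ U p) : U * Uᴴ = 1 :=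
  mul_eq_one_comm.mp h.unitary

lemma conj_eq (h : IsSpecDecomp ρ U p) : Uᴴ * ρ * U = diagonal (fun i => (p i : ℂ)) := by
  rw [h.eq]
  calc Uᴴ * (U * diagonal (fun i => (p i : ℂ)) * Uᴴ) * U
      = (Uᴴ * U) * diagonal (fun i => (p i : ℂ)) * (Uᴴ * U) := by simp only [Matrix.mul_assoc]
    _ = _ := by simp [h.unitary]

lemma trace_eq (h : IsSpecDecomp ρ U p) : ρ.trace = ((∑ i, p i : ℝ) : ℂ) := by
  rw [h.eq, trace_mul_cycle, h.unitary]
  simp [trace]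

lemma add_smul_one (h : IsSpecDecomp ρ U p) (ε : ℝ) :
    IsSpecDecomp (ρ + (ε : ℂ) • 1) U (fun i => p i + ε) := by
  refine ⟨h.unitary, ?_⟩
  have : diagonal (fun i => ((p i + ε : ℝ) : ℂ))
      = diagonal (fun i => (p i : ℂ)) + (ε : ℂ) • (1 : Matrix n n ℂ) := by
    ext i j
    by_cases hij : i = j <;> simp [hij]
  rw [this, Matrix.mul_add, Matrix.add_mul, ← h.eq]
  simp [h.unitary']

lemma smul (h : IsSpecDecomp ρ U p) (c : ℝ) :
    IsSpecDecomp ((c : ℂ) • ρ) U (fun i => c * p i) := by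
  refine ⟨h.unitary, ?_⟩
  have : diagonal (fun i => ((c * p i : ℝ) : ℂ)) = (c : ℂ) • diagonal (fun i => (p i : ℂ)) := by
    ext i j
    by_cases hij : i = j <;> simp [hij]
  rw [this]
  nth_rw 1 [h.eq]
  simp

lemma kronecker {ρ U : Matrix m m ℂ} {p : m → ℝ} (h : IsSpecDecomp ρ U p)
    (h' : IsSpecDecomp σ V q) :
    IsSpecDecomp (ρ ⊗ₖ σ) (U ⊗ₖ V) (fun x => p x.1 * q x.2) := by
  constructor
  · rw [conjTranspose_kronecker, ← mul_kronecker_mul, h.unitary, h'.unitary, one_kronecker_one]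
  · have : diagonal (fun x : m × n => ((p x.1 * q x.2 : ℝ) : ℂ))
        = diagonal (fun i => (p i : ℂ)) ⊗ₖ diagonal (fun i => (q i : ℂ)) := by
      rw [diagonal_kronecker_diagonal]
      simp
    rw [this, conjTranspose_kronecker, ← mul_kronecker_mul, ← mul_kronecker_mul, ← h.eq, ← h'.eq]

lemma one : IsSpecDecomp (1 : Matrix n n ℂ) 1 (fun _ => 1) := by
  constructor <;> simp

lemma of_isHermitian (h : ρ.IsHermitian) :
    IsSpecDecomp ρ (h.eigenvectorUnitary : Matrix n n ℂ) h.eigenvalues := by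
  constructor
  · rw [← star_eq_conjTranspose]
    exact Unitary.coe_star_mul_self _
  · have := h.spectral_theorem
    rw [Unitary.conjStarAlgAut_apply] at this
    exact this

end IsSpecDecomp

/-- A variational functional, affine in `(ρ, σ)`, whose supremum over `X` is the
quasi-entropy integrated below to obtain the relative entropy. -/
noncomputable def varForm (t : ℝ) (ρ σ X : Matrix n n ℂ) : ℝ :=
  (2 * (Xᴴ * ρ).trace - (Xᴴ * σ * X).trace - t * (X * ρ * Xᴴ).trace).re

/-- Squared overlaps of the columns of two matrices. -/
noncomputable def overlap (V U : Matrix n n ℂ) (j i : n) : ℝ := Complex.normSq ((Vᴴ * U) j i)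

section Variational

variable {ρ σ U V : Matrix n n ℂ} {p q : n → ℝ}

lemma varForm_eq_sum (hρ : IsSpecDecomp ρ U p) (hσ : IsSpecDecomp σ V q) (t : ℝ)
    (Y : Matrix n n ℂ) :
    varForm t ρ σ (V * Y * Uᴴ) = ∑ j, ∑ i, (2 * p i * (star (Y j i) * (Vᴴ * U) j i).re
      - (q j + t * p i) * Complex.normSq (Y j i)) := by
  have h1 : ((V * Y * Uᴴ)ᴴ * ρ).trace = (Yᴴ * (Vᴴ * U) * diagonal (fun i => (p i : ℂ))).trace := by
    calc ((V * Y * Uᴴ)ᴴ * ρ).trace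
        = (U * (Yᴴ * Vᴴ * U * diagonal (fun i => (p i : ℂ))) * Uᴴ).trace := by
          nth_rw 1 [hρ.eq]
          simp only [conjTranspose_mul, conjTranspose_conjTranspose, Matrix.mul_assoc]
      _ = _ := by
          rw [trace_mul_cycle, hρ.unitary, Matrix.one_mul]
          simp only [Matrix.mul_assoc]
  have h2 : ((V * Y * Uᴴ)ᴴ * σ * (V * Y * Uᴴ)).trace
      = (Yᴴ * diagonal (fun i => (q i : ℂ)) * Y).trace := by
    calc ((V * Y * Uᴴ)ᴴ * σ * (V * Y * Uᴴ)).trace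
        = (U * (Yᴴ * (Vᴴ * σ * V) * Y) * Uᴴ).trace := by
          simp only [conjTranspose_mul, conjTranspose_conjTranspose, Matrix.mul_assoc]
      _ = _ := by
          rw [trace_mul_cycle, hρ.unitary, Matrix.one_mul, hσ.conj_eq]
  have h3 : ((V * Y * Uᴴ) * ρ * (V * Y * Uᴴ)ᴴ).trace
      = (Y * diagonal (fun i => (p i : ℂ)) * Yᴴ).trace := by
    calc ((V * Y * Uᴴ) * ρ * (V * Y * Uᴴ)ᴴ).trace
        = (V * (Y * (Uᴴ * ρ * U) * Yᴴ) * Vᴴ).trace := by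
          simp only [conjTranspose_mul, conjTranspose_conjTranspose, Matrix.mul_assoc]
      _ = _ := by
          rw [trace_mul_cycle, hσ.unitary, Matrix.one_mul, hρ.conj_eq]
  have e1 : (Yᴴ * (Vᴴ * U) * diagonal (fun i => (p i : ℂ))).trace
      = ∑ j, ∑ i, star (Y j i) * (Vᴴ * U) j i * p i := by
    rw [Finset.sum_comm]
    generalize Vᴴ * U = W
    simp only [trace, diag_apply, mul_diagonal]
    simp only [mul_apply, conjTranspose_apply, Finset.sum_mul]
  have e2 : (Yᴴ * diagonal (fun i => (q i : ℂ)) * Y).trace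
      = ∑ j, ∑ i, ((q j * Complex.normSq (Y j i) : ℝ) : ℂ) := by
    rw [Finset.sum_comm]
    refine Finset.sum_congr rfl fun i _ => ?_
    rw [diag_apply, mul_apply]
    refine Finset.sum_congr rfl fun j _ => ?_
    rw [mul_diagonal, conjTranspose_apply, Complex.ofReal_mul, Complex.normSq_eq_conj_mul_self,
      starRingEnd_apply]
    ring
  have e3 : (Y * diagonal (fun i => (p i : ℂ)) * Yᴴ).trace
      = ∑ j, ∑ i, ((p i * Complex.normSq (Y j i) : ℝ) : ℂ) := by
    refine Finset.sum_congr rfl fun i _ => ?_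
    rw [diag_apply, mul_apply]
    refine Finset.sum_congr rfl fun j _ => ?_
    rw [mul_diagonal, conjTranspose_apply, Complex.ofReal_mul, Complex.normSq_eq_conj_mul_self,
      starRingEnd_apply]
    ring
  rw [varForm, h1, h2, h3, e1, e2, e3]
  simp only [Finset.mul_sum, ← Finset.sum_sub_distrib, Complex.re_sum]
  refine Finset.sum_congr rfl fun j _ => Finset.sum_congr rfl fun i _ => ?_
  generalize star (Y j i) * (Vᴴ * U) j i = z
  rw [← Complex.ofReal_mul, Complex.sub_re, Complex.sub_re, Complex.ofReal_re, Complex.ofReal_re]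
  simp
  ring

lemma varForm_le (hρ : IsSpecDecomp ρ U p) (hσ : IsSpecDecomp σ V q) (hp : ∀ i, 0 ≤ p i)
    (hq : ∀ i, 0 < q i) {t : ℝ} (ht : 0 ≤ t) (X : Matrix n n ℂ) :
    varForm t ρ σ X ≤ ∑ j, ∑ i, overlap V U j i * (p i ^ 2 / (q j + t * p i)) := by
  have hX : X = V * (Vᴴ * X * U) * Uᴴ := by
    calc X = (V * Vᴴ) * X * (U * Uᴴ) := by simp [hρ.unitary', hσ.unitary']
      _ = _ := by simp only [Matrix.mul_assoc]
  rw [hX, varForm_eq_sum hρ hσ]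
  generalize Vᴴ * X * U = Y
  refine Finset.sum_le_sum fun j _ => Finset.sum_le_sum fun i _ => ?_
  unfold overlap
  generalize (Vᴴ * U) j i = w
  generalize Y j i = y
  have hc : 0 < q j + t * p i := by have := mul_nonneg ht (hp i); linarith [hq j]
  rw [← mul_div_assoc, le_div_iff₀ hc]
  simp only [Complex.normSq_apply, Complex.star_def, Complex.mul_re, Complex.conj_re,
    Complex.conj_im]
  nlinarith [sq_nonneg (p i * w.re - (q j + t * p i) * y.re),
    sq_nonneg (p i * w.im - (q j + t * p i) * y.im)]

lemma exists_varForm_eq (hρ : IsSpecDecomp ρ U p) (hσ : IsSpecDecomp σ V q) (hp : ∀ i, 0 ≤ p i)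
    (hq : ∀ i, 0 < q i) {t : ℝ} (ht : 0 ≤ t) :
    ∃ X, varForm t ρ σ X = ∑ j, ∑ i, overlap V U j i * (p i ^ 2 / (q j + t * p i)) := by
  refine ⟨V * (of fun j i => ((p i / (q j + t * p i) : ℝ) : ℂ) * (Vᴴ * U) j i) * Uᴴ, ?_⟩
  rw [varForm_eq_sum hρ hσ]
  refine Finset.sum_congr rfl fun j _ => Finset.sum_congr rfl fun i _ => ?_
  unfold overlap
  rw [of_apply]
  generalize (Vᴴ * U) j i = w
  have hc : 0 < q j + t * p i := by have := mul_nonneg ht (hp i); linarith [hq j]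
  simp only [Complex.normSq_apply, Complex.star_def, Complex.mul_re, Complex.conj_re,
    Complex.conj_im, Complex.mul_im, Complex.ofReal_re, Complex.ofReal_im]
  generalize q j + t * p i = c at hc
  field_simp
  ring

/-- The relative entropy of `U diag(p) Uᴴ` with respect to `V diag(q) Vᴴ`. -/
noncomputable def relEnt (U V : Matrix n n ℂ) (p q : n → ℝ) : ℝ :=
  ∑ j, ∑ i, overlap V U j i * (p i * (Real.log (p i) - Real.log (q j)))

/-- The integral over `[0, T]` of the quasi-entropies. -/
noncomputable def truncEnt (U V : Matrix n n ℂ) (p q : n → ℝ) (T : ℝ) : ℝ :=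
  ∑ j, ∑ i, overlap V U j i * (p i * (Real.log (q j + T * p i) - Real.log (q j)))

lemma sum_overlap (hρ : IsSpecDecomp ρ U p) (hσ : IsSpecDecomp σ V q) (i : n) :
    ∑ j, overlap V U j i = 1 := by
  have h : (Vᴴ * U)ᴴ * (Vᴴ * U) = 1 := by
    calc (Vᴴ * U)ᴴ * (Vᴴ * U) = Uᴴ * (V * Vᴴ) * U := by
          simp only [conjTranspose_mul, conjTranspose_conjTranspose, Matrix.mul_assoc]
      _ = 1 := by rw [hσ.unitary', Matrix.mul_one, hρ.unitary]
  have h' := congrFun (congrFun h i) i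
  rw [mul_apply, one_apply_eq] at h'
  apply Complex.ofReal_injective
  rw [Complex.ofReal_sum, Complex.ofReal_one, ← h']
  refine Finset.sum_congr rfl fun j _ => ?_
  rw [overlap, Complex.normSq_eq_conj_mul_self, conjTranspose_apply, starRingEnd_apply]

lemma hasDerivAt_truncEnt (hp : ∀ i, 0 ≤ p i) (hq : ∀ i, 0 < q i) {t : ℝ} (ht : 0 ≤ t) :
    HasDerivAt (truncEnt U V p q)
      (∑ j, ∑ i, overlap V U j i * (p i ^ 2 / (q j + t * p i))) t := by
  unfold truncEnt
  refine HasDerivAt.fun_sum fun j _ => HasDerivAt.fun_sum fun i _ => ?_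
  refine HasDerivAt.const_mul _ ?_
  have hc : 0 < q j + t * p i := by have := mul_nonneg ht (hp i); linarith [hq j]
  have h1 : HasDerivAt (fun T : ℝ => q j + T * p i) (p i) t := by
    simpa using ((hasDerivAt_id t).mul_const (p i)).const_add (q j)
  have h2 := ((h1.log hc.ne').sub_const (Real.log (q j))).const_mul (p i)
  convert h2 using 1
  ring

lemma tendsto_truncEnt (hρ : IsSpecDecomp ρ U p) (hσ : IsSpecDecomp σ V q) (hp : ∀ i, 0 ≤ p i) :
    Tendsto (fun T => truncEnt U V p q T - (∑ i, p i) * Real.log T) atTop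
      (𝓝 (relEnt U V p q)) := by
  have key : ∀ T, truncEnt U V p q T - (∑ i, p i) * Real.log T
      = ∑ j, ∑ i, overlap V U j i *
        (p i * (Real.log (q j + T * p i) - Real.log T - Real.log (q j))) := by
    intro T
    have : (∑ i, p i) * Real.log T = ∑ j, ∑ i, overlap V U j i * (p i * Real.log T) := by
      rw [Finset.sum_comm, Finset.sum_mul]
      refine Finset.sum_congr rfl fun i _ => ?_
      rw [← Finset.sum_mul, sum_overlap hρ hσ, one_mul]
    rw [this, truncEnt, ← Finset.sum_sub_distrib]
    refine Finset.sum_congr rfl fun j _ => ?_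
    rw [← Finset.sum_sub_distrib]
    refine Finset.sum_congr rfl fun i _ => ?_
    ring
  simp only [key]
  refine tendsto_finsetSum _ fun j _ => tendsto_finsetSum _ fun i _ => ?_
  refine Tendsto.const_mul _ ?_
  rcases (hp i).eq_or_lt with h0 | h0
  · simp [← h0]
  refine Tendsto.const_mul _ (Tendsto.sub_const ?_ _)
  have h1 : Tendsto (fun T : ℝ => q j / T + p i) atTop (𝓝 (0 + p i)) :=
    (tendsto_const_nhds.div_atTop tendsto_id).add_const _
  rw [zero_add] at h1
  have h2 := (Real.continuousAt_log h0.ne').tendsto.comp h1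
  refine h2.congr' ?_
  have h3 : ∀ᶠ T : ℝ in atTop, 0 < q j / T + p i := h1.eventually (lt_mem_nhds h0)
  filter_upwards [eventually_gt_atTop 0, h3] with T hT hT'
  have : q j + T * p i = T * (q j / T + p i) := by field_simp
  rw [this, Real.log_mul hT.ne' hT'.ne']
  simp

/-- Integrating pointwise lower bounds on the quasi-entropies. -/
lemma le_relEnt (hρ : IsSpecDecomp ρ U p) (hσ : IsSpecDecomp σ V q) (hp : ∀ i, 0 ≤ p i)
    (hq : ∀ i, 0 < q i) {G g : ℝ → ℝ} {l : ℝ} (hG0 : G 0 ≤ 0)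
    (hG : ∀ t, 0 ≤ t → HasDerivAt G (g t) t)
    (hg : ∀ t, 0 ≤ t → ∃ X, g t ≤ varForm t ρ σ X)
    (hl : Tendsto (fun T => G T - (∑ i, p i) * Real.log T) atTop (𝓝 l)) :
    l ≤ relEnt U V p q := by
  refine le_of_tendsto_of_tendsto hl (tendsto_truncEnt hρ hσ hp) ?_
  filter_upwards [eventually_ge_atTop 0] with T hT
  have hd : ∀ t ∈ Set.Ici (0 : ℝ), HasDerivAt (fun T => truncEnt U V p q T - G T) _ t :=
    fun t ht => (hasDerivAt_truncEnt hp hq ht).sub (hG t ht)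
  have hmono : MonotoneOn (fun T => truncEnt U V p q T - G T) (Set.Ici 0) := by
    refine monotoneOn_of_deriv_nonneg (convex_Ici 0)
      (fun t ht => (hd t ht).continuousAt.continuousWithinAt)
      (fun t ht => (hd t (interior_subset ht)).differentiableAt.differentiableWithinAt) ?_
    intro t ht
    rw [(hd t (interior_subset ht)).deriv]
    obtain ⟨X, hX⟩ := hg t (interior_subset ht)
    linarith [varForm_le hρ hσ hp hq (interior_subset ht : (0 : ℝ) ≤ t) X]
  have h := hmono (Set.self_mem_Ici) (hT : T ∈ Set.Ici 0) hT
  have h0 : truncEnt U V p q 0 = 0 := by simp [truncEnt]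
  simp only [h0] at h
  linarith

lemma relEnt_eq (hρ : IsSpecDecomp ρ U p) (hσ : IsSpecDecomp σ V q) :
    relEnt U V p q = ∑ i, p i * Real.log (p i)
      - ∑ j, ((Vᴴ * ρ * V) j j).re * Real.log (q j) := by
  have h1 : ∀ j, ((Vᴴ * ρ * V) j j).re = ∑ i, overlap V U j i * p i := by
    intro j
    have : Vᴴ * ρ * V = (Vᴴ * U) * diagonal (fun i => (p i : ℂ)) * (Vᴴ * U)ᴴ := by
      nth_rw 1 [hρ.eq]
      simp only [conjTranspose_mul, conjTranspose_conjTranspose, Matrix.mul_assoc]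
    rw [this, mul_apply, Complex.re_sum]
    refine Finset.sum_congr rfl fun i _ => ?_
    rw [mul_diagonal, conjTranspose_apply, overlap, Complex.normSq_apply]
    simp
    ring
  simp only [h1]
  simp only [Finset.sum_mul, relEnt, mul_sub, Finset.sum_sub_distrib, mul_assoc]
  congr 1
  rw [Finset.sum_comm]
  refine Finset.sum_congr rfl fun i _ => ?_
  rw [← Finset.sum_mul, sum_overlap hρ hσ, one_mul]

end Variational

end

section

variable {m n : Type*} [Fintype m] [DecidableEq m] [Fintype n] [DecidableEq n]

section Entropy

lemma vN_eq_sum {ρ : Matrix n n ℂ} (h : ρ.IsHermitian) :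
    vN ρ = -∑ i, h.eigenvalues i * Real.log (h.eigenvalues i) := by
  rw [vN, dif_pos h]

lemma vN_eq_roots {ρ : Matrix n n ℂ} (h : ρ.IsHermitian) :
    vN ρ = (ρ.charpoly.roots.map fun z => Real.negMulLog z.re).sum := by
  rw [vN_eq_sum h, h.roots_charpoly_eq_eigenvalues, Multiset.map_map, ← Finset.sum_neg_distrib]
  change _ = ∑ i, _
  simp [Real.negMulLog]

lemma vN_submatrix {ρ : Matrix n n ℂ} (h : ρ.IsHermitian) (e : m ≃ n) :
    vN (ρ.submatrix e e) = vN ρ := by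
  rw [vN_eq_roots h, vN_eq_roots (h.submatrix e)]
  have := charpoly_reindex e.symm ρ
  simp only [reindex_apply, Equiv.symm_symm] at this
  rw [this]

lemma vN_mul_conjTranspose_self (K : Matrix m n ℂ) : vN (K * Kᴴ) = vN (Kᵀ * Kᵀᴴ) := by
  have hT : Kᵀ * Kᵀᴴ = (Kᴴ * K)ᵀ := by
    rw [transpose_mul]
    rfl
  rw [vN_eq_roots (isHermitian_mul_conjTranspose_self K),
    vN_eq_roots (isHermitian_mul_conjTranspose_self Kᵀ), hT, charpoly_transpose]
  have h := congrArg (fun P => (P.roots.map fun z : ℂ => Real.negMulLog z.re).sum)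
    (charpoly_mul_comm' K Kᴴ)
  have hne : ∀ k : ℕ, (Polynomial.X ^ k : Polynomial ℂ) ≠ 0 := fun k =>
    pow_ne_zero _ Polynomial.X_ne_zero
  simpa [Polynomial.roots_mul (mul_ne_zero (hne _) (charpoly_monic _).ne_zero),
    Multiset.map_nsmul, Multiset.sum_nsmul] using h

lemma relEnt_eigen {ρ σ V : Matrix n n ℂ} {q : n → ℝ} (hρ : ρ.IsHermitian)
    (hσ : IsSpecDecomp σ V q) :
    relEnt (hρ.eigenvectorUnitary : Matrix n n ℂ) V hρ.eigenvalues q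
      = -vN ρ - ∑ j, ((Vᴴ * ρ * V) j j).re * Real.log (q j) := by
  rw [relEnt_eq (IsSpecDecomp.of_isHermitian hρ) hσ, vN_eq_sum hρ, neg_neg]

end Entropy

section Pinsker

open scoped MatrixOrder

variable {ρ σ U V : Matrix n n ℂ} {p q : n → ℝ}

lemma re_trace_mul_nonneg {ρ M : Matrix n n ℂ} (hρ : ρ.PosSemidef) (hM : M.PosSemidef) :
    0 ≤ (ρ * M).trace.re := by
  obtain ⟨B, rfl⟩ := CStarAlgebra.nonneg_iff_eq_star_mul_self.mp hM.nonneg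
  rw [star_eq_conjTranspose]
  rw [← Matrix.mul_assoc, trace_mul_comm, ← Matrix.mul_assoc]
  exact (Complex.le_def.mp (hρ.mul_mul_conjTranspose_same B).trace_nonneg).1

lemma re_trace_mul_sq_le {M : Matrix n n ℂ} (hσ : σ.PosSemidef) (hσ1 : σ.trace = 1)
    (hM : (1 - M * M).PosSemidef) : (σ * (M * M)).trace.re ≤ 1 := by
  have h := re_trace_mul_nonneg hσ hM
  rw [Matrix.mul_sub, trace_sub, Matrix.mul_one, hσ1] at h
  simpa using h

/-- Quantum Pinsker inequality for the observable `M` with `M² ≤ 1`. -/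
lemma pinsker {M : Matrix n n ℂ} (hρ : IsSpecDecomp ρ U p) (hσ : IsSpecDecomp σ V q)
    (hρ0 : ρ.PosSemidef) (hσ0 : σ.PosSemidef) (hp : ∀ i, 0 ≤ p i) (hq : ∀ i, 0 < q i)
    (hρ1 : ρ.trace = 1) (hσ1 : σ.trace = 1) (hMh : M.IsHermitian)
    (hM : (1 - M * M).PosSemidef) :
    ((ρ * M).trace.re - (σ * M).trace.re) ^ 2 / 2 ≤ relEnt U V p q := by
  set r := (ρ * M).trace.re with hr
  set s := (σ * M).trace.re with hs
  have hp1 : ∑ i, p i = 1 := by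
    have := hρ.trace_eq.symm.trans hρ1
    exact_mod_cast this
  refine le_relEnt hρ hσ hp hq
    (G := fun T => Real.log (1 + T) + (r - s) ^ 2 / 2 * (1 - ((1 + T) ^ 2)⁻¹))
    (g := fun t => 1 / (1 + t) + (r - s) ^ 2 / (1 + t) ^ 3) ?_ ?_ ?_ ?_
  · simp
  · intro t ht
    have h0 : (0 : ℝ) < 1 + t := by linarith
    have h1 : HasDerivAt (fun T : ℝ => 1 + T) 1 t := (hasDerivAt_id t).const_add 1
    have h2 := (h1.log h0.ne').add
      ((((h1.pow 2).inv (pow_pos h0 2).ne').const_sub 1).const_mul ((r - s) ^ 2 / 2))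
    refine h2.congr_deriv ?_
    norm_num
    field_simp
  · intro t ht
    have h0 : (0 : ℝ) < 1 + t := by linarith
    set b : ℝ := (r - s) / (1 + t) ^ 2 with hb
    set a : ℝ := (1 - b * (s + t * r)) / (1 + t) with ha
    refine ⟨(a : ℂ) • 1 + (b : ℂ) • M, ?_⟩
    set X : Matrix n n ℂ := (a : ℂ) • 1 + (b : ℂ) • M with hX
    have hXh : Xᴴ = X := by simp [hX, hMh.eq]
    have hXX : X * X = ((a ^ 2 : ℝ) : ℂ) • 1 + ((2 * a * b : ℝ) : ℂ) • M
        + ((b ^ 2 : ℝ) : ℂ) • (M * M) := by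
      simp only [hX, Matrix.mul_add, Matrix.add_mul, Matrix.smul_mul, Matrix.mul_smul,
        Matrix.one_mul, Matrix.mul_one]
      push_cast
      module
    have hsq : ∀ τ : Matrix n n ℂ, τ.trace = 1 → (τ * (X * X)).trace.re
        = a ^ 2 + 2 * a * b * (τ * M).trace.re + b ^ 2 * (τ * (M * M)).trace.re := by
      intro τ hτ
      rw [hXX]
      simp only [Matrix.mul_add, Matrix.mul_smul, mul_one, trace_add, trace_smul,
        smul_eq_mul, Complex.add_re, Complex.re_ofReal_mul, hτ, Complex.ofReal_re]
    have e1 : (X * ρ).trace.re = a + b * r := by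
      rw [hX, Matrix.add_mul]
      simp only [Matrix.smul_mul, Matrix.one_mul, trace_add, trace_smul,
        smul_eq_mul, Complex.add_re, Complex.re_ofReal_mul, hρ1, Complex.ofReal_re, mul_one, hr,
        trace_mul_comm M ρ]
    have e2 : (X * σ * X).trace.re = (σ * (X * X)).trace.re := by
      rw [trace_mul_comm, ← Matrix.mul_assoc, trace_mul_comm]
    have e3 : (X * ρ * X).trace.re = (ρ * (X * X)).trace.re := by
      rw [trace_mul_comm, ← Matrix.mul_assoc, trace_mul_comm]
    have hform : varForm t ρ σ X
        = 2 * (X * ρ).trace.re - (X * σ * X).trace.re - t * (X * ρ * X).trace.re := by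
      rw [varForm, hXh]
      simp
    rw [hform, e1, e2, e3, hsq σ hσ1, hsq ρ hρ1, ← hr, ← hs]
    have f1 := mul_le_mul_of_nonneg_left (re_trace_mul_sq_le hσ0 hσ1 hM) (sq_nonneg b)
    have f2 := mul_le_mul_of_nonneg_left (re_trace_mul_sq_le hρ0 hρ1 hM)
      (mul_nonneg ht (sq_nonneg b))
    set c := 1 + t with hc
    have f3 : 2 * (a + b * r) - (1 + t) * (a ^ 2 + b ^ 2) - 2 * a * b * (s + t * r)
        = 1 / (1 + t) + (r - s) ^ 2 / (1 + t) ^ 3 + b ^ 2 * (s + t * r) ^ 2 / (1 + t) := by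
      have ht' : t = c - 1 := by rw [hc]; ring
      rw [ha, hb, ← hc, ht']
      field_simp
      ring
    have f4 : 0 ≤ b ^ 2 * (s + t * r) ^ 2 / (1 + t) := by positivity
    rw [← hc] at f3
    rw [← hc] at f4
    nlinarith
  · rw [hp1]
    have h1 : Tendsto (fun T : ℝ => (1 + T)) atTop atTop :=
      tendsto_atTop_add_const_left _ _ tendsto_id
    have h2 : Tendsto (fun T : ℝ => ((1 + T) ^ 2)⁻¹) atTop (𝓝 0) :=
      tendsto_inv_atTop_zero.comp ((tendsto_pow_atTop two_ne_zero).comp h1)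
    have h3 : Tendsto (fun T : ℝ => Real.log (1 + T) - Real.log T) atTop (𝓝 0) := by
      have h4 : Tendsto (fun T : ℝ => T⁻¹ + 1) atTop (𝓝 (0 + 1)) :=
        tendsto_inv_atTop_zero.add_const 1
      rw [zero_add] at h4
      have h5 := (Real.continuousAt_log one_ne_zero).tendsto.comp h4
      rw [Real.log_one] at h5
      refine h5.congr' ?_
      filter_upwards [eventually_gt_atTop 0] with T hT
      have : T⁻¹ + 1 = (1 + T) / T := by field_simp
      rw [Function.comp_apply, this, Real.log_div (by positivity) hT.ne']
    have h6 := h3.add ((h2.const_sub 1).const_mul ((r - s) ^ 2 / 2))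
    simp only [zero_add, sub_zero, mul_one] at h6
    refine h6.congr fun T => ?_
    ring

end Pinsker

end

section PartialTrace

variable {A B C : Type*} [Fintype A] [DecidableEq A] [Fintype B] [DecidableEq B]
  [Fintype C] [DecidableEq C]

lemma posSemidef_sum_submatrix {ι m n : Type*} [Fintype ι] {ρ : Matrix n n ℂ}
    (h : ρ.PosSemidef) (f : ι → m → n) :
    (of fun x y => ∑ k, ρ (f k x) (f k y) : Matrix m m ℂ).PosSemidef := by
  have : (of fun x y => ∑ k, ρ (f k x) (f k y) : Matrix m m ℂ)
      = ∑ k, ρ.submatrix (f k) (f k) := by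
    ext x y
    simp [Matrix.sum_apply]
  rw [this]
  exact posSemidef_sum _ fun k _ => h.submatrix (f k)

lemma posSemidef_ptraceA {ρ : Matrix (A × B) (A × B) ℂ} (h : ρ.PosSemidef) :
    (ptraceA ρ).PosSemidef :=
  posSemidef_sum_submatrix h fun a b => (a, b)

lemma posSemidef_ptraceB {ρ : Matrix (A × B) (A × B) ℂ} (h : ρ.PosSemidef) :
    (ptraceB ρ).PosSemidef :=
  posSemidef_sum_submatrix h fun b a => (a, b)

lemma posSemidef_ptraceB3 {ρ : Matrix (A × B × C) (A × B × C) ℂ} (h : ρ.PosSemidef) :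
    (ptraceB3 ρ).PosSemidef :=
  posSemidef_sum_submatrix h fun b (x : A × C) => (x.1, b, x.2)

lemma trace_ptraceA (ρ : Matrix (A × B) (A × B) ℂ) : (ptraceA ρ).trace = ρ.trace := by
  simp only [trace, diag_apply, ptraceA, of_apply, Fintype.sum_prod_type]
  exact Finset.sum_comm

lemma trace_ptraceB (ρ : Matrix (A × B) (A × B) ℂ) : (ptraceB ρ).trace = ρ.trace := by
  simp only [trace, diag_apply, ptraceB, of_apply, Fintype.sum_prod_type]

lemma trace_mul_one_kronecker (ρ : Matrix (A × B) (A × B) ℂ) (N : Matrix B B ℂ) :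
    (ρ * ((1 : Matrix A A ℂ) ⊗ₖ N)).trace = (ptraceA ρ * N).trace := by
  simp only [trace, diag_apply, mul_apply, ptraceA, of_apply, Fintype.sum_prod_type,
    kroneckerMap_apply, one_apply, ite_mul, one_mul, zero_mul, mul_ite, mul_zero]
  rw [Finset.sum_comm]
  refine Finset.sum_congr rfl fun b _ => ?_
  simp only [Finset.sum_mul]
  rw [Finset.sum_comm (s := Finset.univ (α := B))]
  refine Finset.sum_congr rfl fun a _ => ?_
  rw [Finset.sum_eq_single a (fun a' _ h => by simp [h]) (by simp)]
  simp

lemma trace_mul_kronecker_one (ρ : Matrix (A × B) (A × B) ℂ) (N : Matrix A A ℂ) :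
    (ρ * (N ⊗ₖ (1 : Matrix B B ℂ))).trace = (ptraceB ρ * N).trace := by
  simp only [trace, diag_apply, mul_apply, ptraceB, of_apply, Fintype.sum_prod_type,
    kroneckerMap_apply, one_apply, mul_ite, mul_one, mul_zero]
  refine Finset.sum_congr rfl fun a _ => ?_
  simp only [Finset.sum_mul]
  rw [Finset.sum_comm]
  refine Finset.sum_congr rfl fun a' _ => ?_
  refine Finset.sum_congr rfl fun b _ => ?_
  simp

/-- The operator acting as `Y` on the first and third factors and trivially on the second. -/
def liftB (Y : Matrix (A × C) (A × C) ℂ) : Matrix (A × B × C) (A × B × C) ℂ :=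
  of fun x y => if x.2.1 = y.2.1 then Y (x.1, x.2.2) (y.1, y.2.2) else 0

lemma conjTranspose_liftB (Y : Matrix (A × C) (A × C) ℂ) :
    (liftB (B := B) Y)ᴴ = liftB Yᴴ := by
  ext x y
  simp only [liftB, conjTranspose_apply, of_apply, apply_ite star, star_zero, eq_comm]

lemma liftB_mul (Y Z : Matrix (A × C) (A × C) ℂ) :
    liftB (B := B) Y * liftB Z = liftB (Y * Z) := by
  ext x y
  simp only [liftB, mul_apply, of_apply, Fintype.sum_prod_type]
  by_cases h : x.2.1 = y.2.1
  · simp only [h, if_true]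
    refine Finset.sum_congr rfl fun a _ => ?_
    rw [Finset.sum_eq_single y.2.1 (fun b _ hb => by simp [hb]) (by simp)]
    simp
  · simp only [h, if_false]
    refine Finset.sum_eq_zero fun a _ => Finset.sum_eq_zero fun b _ =>
      Finset.sum_eq_zero fun c _ => ?_
    by_cases hb : x.2.1 = b
    · have : ¬ b = y.2.1 := fun h' => h (hb.trans h')
      simp [this]
    · simp [hb]

lemma trace_liftB_mul (Y : Matrix (A × C) (A × C) ℂ) (ρ : Matrix (A × B × C) (A × B × C) ℂ) :
    (liftB Y * ρ).trace = (Y * ptraceB3 ρ).trace := by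
  simp only [trace, diag_apply, mul_apply, ptraceB3, liftB, of_apply, Fintype.sum_prod_type,
    ite_mul, zero_mul, Finset.mul_sum]
  refine Finset.sum_congr rfl fun a _ => ?_
  rw [Finset.sum_comm]
  refine Finset.sum_congr rfl fun c _ => ?_
  rw [Finset.sum_comm]
  refine Finset.sum_congr rfl fun a' _ => ?_
  conv_rhs => rw [Finset.sum_comm]
  refine Finset.sum_congr rfl fun b _ => ?_
  rw [Finset.sum_eq_single b (fun b' _ h => by simp [h.symm]) (by simp)]
  simp

lemma varForm_liftB (t : ℝ) (ρ σ : Matrix (A × B × C) (A × B × C) ℂ)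
    (Y : Matrix (A × C) (A × C) ℂ) :
    varForm t ρ σ (liftB Y) = varForm t (ptraceB3 ρ) (ptraceB3 σ) Y := by
  have h2 : ((liftB Y)ᴴ * σ * liftB Y).trace = (Yᴴ * ptraceB3 σ * Y).trace := by
    rw [trace_mul_comm, ← Matrix.mul_assoc, conjTranspose_liftB, liftB_mul, trace_liftB_mul,
      Matrix.mul_assoc, trace_mul_comm]
  have h3 : (liftB Y * ρ * (liftB Y)ᴴ).trace = (Y * ptraceB3 ρ * Yᴴ).trace := by
    rw [trace_mul_comm, ← Matrix.mul_assoc, conjTranspose_liftB, liftB_mul, trace_liftB_mul,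
      Matrix.mul_assoc, trace_mul_comm]
  rw [varForm, varForm, h2, h3, conjTranspose_liftB, trace_liftB_mul]

lemma trace_ptraceB3 (ρ : Matrix (A × B × C) (A × B × C) ℂ) :
    (ptraceB3 ρ).trace = ρ.trace := by
  simp only [trace, diag_apply, ptraceB3, of_apply, Fintype.sum_prod_type]
  exact Finset.sum_congr rfl fun a _ => Finset.sum_comm

lemma sum_diag_mul_snd {ρ : Matrix (A × B) (A × B) ℂ} {U : Matrix A A ℂ} {V : Matrix B B ℂ}
    {q : B → ℝ} (hU : U * Uᴴ = 1) (h : IsSpecDecomp (ptraceA ρ) V q) (f : B → ℝ) :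
    ∑ x, (((U ⊗ₖ V)ᴴ * ρ * (U ⊗ₖ V)) x x).re * f x.2 = ∑ b, q b * f b := by
  have h1 : (((U ⊗ₖ V)ᴴ * ρ * (U ⊗ₖ V)) *
      ((1 : Matrix A A ℂ) ⊗ₖ diagonal (fun b => (f b : ℂ)))).trace
      = ((∑ b, q b * f b : ℝ) : ℂ) := by
    have e : (((U ⊗ₖ V)ᴴ * ρ * (U ⊗ₖ V)) *
        ((1 : Matrix A A ℂ) ⊗ₖ diagonal (fun b => (f b : ℂ)))).trace
        = (ρ * ((U ⊗ₖ V) * ((1 : Matrix A A ℂ) ⊗ₖ diagonal (fun b => (f b : ℂ)))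
          * (U ⊗ₖ V)ᴴ)).trace := by
      rw [Matrix.mul_assoc, Matrix.mul_assoc, trace_mul_comm]
      simp only [Matrix.mul_assoc]
    rw [e, conjTranspose_kronecker, ← mul_kronecker_mul, ← mul_kronecker_mul, Matrix.mul_one, hU,
      trace_mul_one_kronecker, ← Matrix.mul_assoc, trace_mul_comm, ← Matrix.mul_assoc,
      ← Matrix.mul_assoc, h.conj_eq, diagonal_mul_diagonal]
    simp [trace]
  have h2 := congrArg Complex.re h1
  rw [Complex.ofReal_re] at h2
  rw [← h2, ← diagonal_one, diagonal_kronecker_diagonal, trace, Complex.re_sum]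
  refine Finset.sum_congr rfl fun x _ => ?_
  rw [diag_apply, mul_diagonal]
  simp

lemma sum_diag_mul_fst {ρ : Matrix (A × B) (A × B) ℂ} {U : Matrix A A ℂ} {V : Matrix B B ℂ}
    {p : A → ℝ} (hV : V * Vᴴ = 1) (h : IsSpecDecomp (ptraceB ρ) U p) (f : A → ℝ) :
    ∑ x, (((U ⊗ₖ V)ᴴ * ρ * (U ⊗ₖ V)) x x).re * f x.1 = ∑ a, p a * f a := by
  have h1 : (((U ⊗ₖ V)ᴴ * ρ * (U ⊗ₖ V)) *
      (diagonal (fun a => (f a : ℂ)) ⊗ₖ (1 : Matrix B B ℂ))).trace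
      = ((∑ a, p a * f a : ℝ) : ℂ) := by
    have e : (((U ⊗ₖ V)ᴴ * ρ * (U ⊗ₖ V)) *
        (diagonal (fun a => (f a : ℂ)) ⊗ₖ (1 : Matrix B B ℂ))).trace
        = (ρ * ((U ⊗ₖ V) * (diagonal (fun a => (f a : ℂ)) ⊗ₖ (1 : Matrix B B ℂ))
          * (U ⊗ₖ V)ᴴ)).trace := by
      rw [Matrix.mul_assoc, Matrix.mul_assoc, trace_mul_comm]
      simp only [Matrix.mul_assoc]
    rw [e, conjTranspose_kronecker, ← mul_kronecker_mul, ← mul_kronecker_mul, Matrix.mul_one, hV,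
      trace_mul_kronecker_one, ← Matrix.mul_assoc, trace_mul_comm, ← Matrix.mul_assoc,
      ← Matrix.mul_assoc, h.conj_eq, diagonal_mul_diagonal]
    simp [trace]
  have h2 := congrArg Complex.re h1
  rw [Complex.ofReal_re] at h2
  rw [← h2, ← diagonal_one, diagonal_kronecker_diagonal, trace, Complex.re_sum]
  refine Finset.sum_congr rfl fun x _ => ?_
  rw [diag_apply, mul_diagonal]
  simp

end PartialTrace

section StrongSubadditivity

lemma tendsto_sum_mul_log {ι n : Type*} [Fintype n] {l : Filter ι} {q : n → ℝ} {u : ι → n → ℝ}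
    (hu : ∀ j, Tendsto (fun ε => u ε j) l (𝓝 (q j))) :
    Tendsto (fun ε => ∑ j, q j * Real.log (u ε j)) l (𝓝 (∑ j, q j * Real.log (q j))) := by
  refine tendsto_finsetSum _ fun j _ => ?_
  by_cases h : q j = 0
  · simpa [h] using tendsto_const_nhds
  · exact ((Real.continuousAt_log h).tendsto.comp (hu j)).const_mul _

lemma relEnt_mono {m n : Type*} [Fintype m] [DecidableEq m] [Fintype n] [DecidableEq n]
    {ρ σ U V : Matrix n n ℂ} {p q : n → ℝ} {ρ' σ' U' V' : Matrix m m ℂ} {p' q' : m → ℝ}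
    (hρ : IsSpecDecomp ρ U p) (hσ : IsSpecDecomp σ V q) (hp : ∀ i, 0 ≤ p i) (hq : ∀ i, 0 < q i)
    (hρ' : IsSpecDecomp ρ' U' p') (hσ' : IsSpecDecomp σ' V' q') (hp' : ∀ i, 0 ≤ p' i)
    (hq' : ∀ i, 0 < q' i) (htr : ρ'.trace = ρ.trace)
    (hX : ∀ t X', ∃ X, varForm t ρ' σ' X' = varForm t ρ σ X) :
    relEnt U' V' p' q' ≤ relEnt U V p q := by
  have hsum : ∑ i, p' i = ∑ i, p i := by
    rw [hρ.trace_eq, hρ'.trace_eq] at htr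
    exact_mod_cast htr
  refine le_relEnt hρ hσ hp hq (G := truncEnt U' V' p' q') (by simp [truncEnt])
    (fun t ht => hasDerivAt_truncEnt hp' hq' ht) ?_ (hsum ▸ tendsto_truncEnt hρ' hσ' hp')
  intro t ht
  obtain ⟨X', hX'⟩ := exists_varForm_eq hρ' hσ' hp' hq' ht
  obtain ⟨X, hX⟩ := hX t X'
  exact ⟨X, by rw [← hX', hX]⟩

variable {A B C : Type*} [Fintype A] [DecidableEq A] [Fintype B] [DecidableEq B]
  [Fintype C] [DecidableEq C]

lemma ptraceB3_one_kronecker (σ : Matrix (B × C) (B × C) ℂ) :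
    ptraceB3 ((1 : Matrix A A ℂ) ⊗ₖ σ) = 1 ⊗ₖ ptraceA σ := by
  ext x y
  simp [ptraceB3, ptraceA, Finset.mul_sum]

lemma ptraceA_add_smul_one (σ : Matrix (B × C) (B × C) ℂ) (ε : ℝ) :
    ptraceA (σ + (ε : ℂ) • 1) = ptraceA σ + ((Fintype.card B * ε : ℝ) : ℂ) • 1 := by
  ext x y
  by_cases h : x = y
  · simp [ptraceA, h, Finset.sum_add_distrib]
  · simp [ptraceA, h]

/-- Strong subadditivity of the von Neumann entropy. -/
theorem strong_subadditivity [Nonempty B] {ρ : Matrix (A × B × C) (A × B × C) ℂ}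
    (h : ρ.PosSemidef) :
    vN ρ + vN (ptraceA (ptraceA ρ)) ≤ vN (ptraceB3 ρ) + vN (ptraceA ρ) := by
  have hBC := posSemidef_ptraceA h
  have hC := posSemidef_ptraceA hBC
  have hAC := posSemidef_ptraceB3 h
  have sBC := IsSpecDecomp.of_isHermitian hBC.isHermitian
  have sC := IsSpecDecomp.of_isHermitian hC.isHermitian
  have hcard : (0 : ℝ) < Fintype.card B := by exact_mod_cast Fintype.card_pos
  have hC' : ptraceA (ptraceB3 ρ) = ptraceA (ptraceA ρ) := by
    ext x y
    simp only [ptraceA, ptraceB3, of_apply]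
    exact Finset.sum_comm
  have sC' : IsSpecDecomp (ptraceA (ptraceB3 ρ)) _ _ := ⟨sC.unitary, hC'.trans sC.eq⟩
  have key : ∀ ε : ℝ, 0 < ε →
      -vN (ptraceB3 ρ) - ∑ j, hC.isHermitian.eigenvalues j
        * Real.log (hC.isHermitian.eigenvalues j + Fintype.card B * ε)
      ≤ -vN ρ - ∑ j, hBC.isHermitian.eigenvalues j
        * Real.log (hBC.isHermitian.eigenvalues j + ε) := by
    intro ε hε
    have sσ := (IsSpecDecomp.one (n := A)).kronecker (sBC.add_smul_one ε)
    have sσ' := (IsSpecDecomp.one (n := A)).kronecker (sC.add_smul_one (Fintype.card B * ε))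
    have hmono := relEnt_mono (IsSpecDecomp.of_isHermitian h.isHermitian) sσ h.eigenvalues_nonneg
      (fun x => by have := hBC.eigenvalues_nonneg x.2; linarith)
      (IsSpecDecomp.of_isHermitian hAC.isHermitian) sσ' hAC.eigenvalues_nonneg
      (fun x => by
        have := hC.eigenvalues_nonneg x.2
        have := mul_pos hcard hε
        linarith)
      (trace_ptraceB3 ρ)
      (fun t X' => ⟨liftB X', by
        rw [varForm_liftB, ptraceB3_one_kronecker, ptraceA_add_smul_one]⟩)
    rw [relEnt_eigen _ sσ, relEnt_eigen _ sσ'] at hmono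
    simp only [one_mul] at hmono
    rw [sum_diag_mul_snd (by simp) sBC
        (fun j => Real.log (hBC.isHermitian.eigenvalues j + ε)),
      sum_diag_mul_snd (by simp) sC'
        (fun j => Real.log (hC.isHermitian.eigenvalues j + Fintype.card B * ε))] at hmono
    exact hmono
  have l1 : Tendsto (fun ε : ℝ => ∑ j, hC.isHermitian.eigenvalues j
        * Real.log (hC.isHermitian.eigenvalues j + Fintype.card B * ε)) (𝓝[>] 0)
        (𝓝 (∑ j, hC.isHermitian.eigenvalues j * Real.log (hC.isHermitian.eigenvalues j))) := by
    refine tendsto_sum_mul_log fun j => Tendsto.mono_left ?_ nhdsWithin_le_nhds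
    exact Continuous.tendsto' (by fun_prop) _ _ (by simp)
  have l2 : Tendsto (fun ε : ℝ => ∑ j, hBC.isHermitian.eigenvalues j
        * Real.log (hBC.isHermitian.eigenvalues j + ε)) (𝓝[>] 0)
        (𝓝 (∑ j, hBC.isHermitian.eigenvalues j * Real.log (hBC.isHermitian.eigenvalues j))) := by
    refine tendsto_sum_mul_log fun j => Tendsto.mono_left ?_ nhdsWithin_le_nhds
    exact Continuous.tendsto' (by fun_prop) _ _ (by simp)
  have hlim := le_of_tendsto_of_tendsto (l1.const_sub (-vN (ptraceB3 ρ))) (l2.const_sub (-vN ρ))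
    (by filter_upwards [self_mem_nhdsWithin] with ε hε using key ε hε)
  rw [vN_eq_sum hBC.isHermitian, vN_eq_sum hC.isHermitian]
  linarith

end StrongSubadditivity

section WeakMonotonicity

open scoped MatrixOrder

variable {A B C : Type*} [Fintype A] [DecidableEq A] [Fintype B] [DecidableEq B]
  [Fintype C] [DecidableEq C]

lemma posSemidef_ptraceC3 {ρ : Matrix (A × B × C) (A × B × C) ℂ} (h : ρ.PosSemidef) :
    (ptraceC3 ρ).PosSemidef :=
  posSemidef_sum_submatrix h fun c (x : A × B) => (x.1, x.2, c)

/-- Weak monotonicity of the von Neumann entropy, by purification from strong subadditivity. -/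
theorem weak_monotonicity [Nonempty B] {ρ : Matrix (A × B × C) (A × B × C) ℂ}
    (h : ρ.PosSemidef) :
    vN (ptraceB (ptraceC3 ρ)) + vN (ptraceA (ptraceA ρ)) ≤ vN (ptraceC3 ρ) + vN (ptraceA ρ) := by
  obtain ⟨K', hK'⟩ := CStarAlgebra.nonneg_iff_eq_star_mul_self.mp h.nonneg
  set K : Matrix (A × B × C) (A × B × C) ℂ := K'ᴴ with hK
  have hρ : ∀ x y, ρ x y = ∑ r, K x r * star (K y r) := by
    intro x y
    rw [hK', star_eq_conjTranspose, mul_apply]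
    simp [hK, conjTranspose_apply]
  let N : Matrix ((A × B × C) × B × C) A ℂ := of fun x a => K (a, x.2.1, x.2.2) x.1
  let L : Matrix ((A × B × C) × C) (A × B) ℂ := of fun x y => K (y.1, y.2, x.2) x.1
  have h1 : Nᵀ * Nᵀᴴ = ptraceB (ptraceC3 ρ) := by
    ext a a'
    simp only [N, ptraceB, ptraceC3, of_apply, mul_apply, conjTranspose_apply, transpose_apply, hρ]
    rw [Fintype.sum_prod_type_right, Fintype.sum_prod_type]
  have h2 : ptraceB3 (N * Nᴴ) = L * Lᴴ := by
    ext x y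
    simp only [N, L, ptraceB3, of_apply, mul_apply, conjTranspose_apply]
    rw [Fintype.sum_prod_type_right]
  have h3 : Lᵀ * Lᵀᴴ = ptraceC3 ρ := by
    ext x y
    simp only [L, ptraceC3, of_apply, mul_apply, conjTranspose_apply, transpose_apply, hρ]
    rw [Fintype.sum_prod_type_right]
  have h4 : ptraceA (N * Nᴴ) = ptraceA ρ := by
    ext x y
    simp only [N, ptraceA, of_apply, mul_apply, conjTranspose_apply, hρ]
    exact Finset.sum_comm
  have hs := strong_subadditivity (posSemidef_self_mul_conjTranspose N)
  rwa [vN_mul_conjTranspose_self, h1, h2, vN_mul_conjTranspose_self, h3, h4] at hs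

theorem strong_subadditivity_snd [Nonempty C] {ρ : Matrix (A × B × C) (A × B × C) ℂ}
    (h : ρ.PosSemidef) :
    vN ρ + vN (ptraceA (ptraceC3 ρ)) ≤ vN (ptraceC3 ρ) + vN (ptraceA ρ) := by
  let e : A × C × B ≃ A × B × C := (Equiv.refl A).prodCongr (Equiv.prodComm C B)
  have hs := strong_subadditivity (h.submatrix e)
  have h1 : ptraceB3 (ρ.submatrix e e) = ptraceC3 ρ := rfl
  have h2 : ptraceA (ρ.submatrix e e)
      = (ptraceA ρ).submatrix (Equiv.prodComm C B) (Equiv.prodComm C B) := rfl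
  have h3 : ptraceA ((ptraceA ρ).submatrix (Equiv.prodComm C B) (Equiv.prodComm C B))
      = ptraceA (ptraceC3 ρ) := by
    ext x y
    simp only [ptraceA, ptraceC3, of_apply, submatrix_apply]
    exact Finset.sum_comm
  rwa [vN_submatrix h.isHermitian, h1, h2, h3,
    vN_submatrix (posSemidef_ptraceA h).isHermitian] at hs

theorem le_condMutualInfo [Nonempty A] [Nonempty B] [Nonempty C]
    {ρ : Matrix (A × B × C) (A × B × C) ℂ} (h : ρ.PosSemidef) :
    vN (ptraceB (ptraceC3 ρ)) + vN (ptraceA (ptraceC3 ρ)) - 2 * vN (ptraceC3 ρ)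
      ≤ condMutualInfo ρ := by
  let f : B × A × C → A × B × C := fun x => (x.2.1, x.1, x.2.2)
  let e : B × A × C ≃ A × B × C :=
    ⟨f, fun x => (x.2.1, x.1, x.2.2), fun _ => rfl, fun _ => rfl⟩
  have hτ := h.submatrix e
  have h1 : ptraceC3 (ρ.submatrix e e)
      = (ptraceC3 ρ).submatrix (Equiv.prodComm B A) (Equiv.prodComm B A) := rfl
  have h2 : ptraceA (ρ.submatrix e e) = ptraceB3 ρ := rfl
  have h3 : ptraceA (ptraceB3 ρ) = ptraceA (ptraceA ρ) := by
    ext x y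
    simp only [ptraceA, ptraceB3, of_apply]
    exact Finset.sum_comm
  have h4 : ptraceB ((ptraceC3 ρ).submatrix (Equiv.prodComm B A) (Equiv.prodComm B A))
      = ptraceA (ptraceC3 ρ) := rfl
  have h5 : ptraceA ((ptraceC3 ρ).submatrix (Equiv.prodComm B A) (Equiv.prodComm B A))
      = ptraceB (ptraceC3 ρ) := rfl
  have w1 := weak_monotonicity h
  have w2 := weak_monotonicity hτ
  have s1 := strong_subadditivity_snd h
  have s2 := strong_subadditivity_snd hτ
  rw [h1, h2, h3, h4, vN_submatrix (posSemidef_ptraceC3 h).isHermitian] at w2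
  rw [h1, h2, h5, vN_submatrix (posSemidef_ptraceC3 h).isHermitian,
    vN_submatrix h.isHermitian] at s2
  rw [condMutualInfo]
  linarith

end WeakMonotonicity

section MutualInformation

variable {A B : Type*} [Fintype A] [DecidableEq A] [Fintype B] [DecidableEq B]

/-- The normalized full-rank perturbation of a density matrix. -/
lemma IsSpecDecomp.perturb {n : Type*} [Fintype n] [DecidableEq n] {ρ U : Matrix n n ℂ}
    {p : n → ℝ} (h : IsSpecDecomp ρ U p) (ε : ℝ) :
    IsSpecDecomp (((1 + Fintype.card n * ε)⁻¹ : ℝ) • (ρ + (ε : ℂ) • 1)) U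
      (fun i => (1 + Fintype.card n * ε)⁻¹ * (p i + ε)) := by
  rw [← Complex.coe_smul]
  exact (h.add_smul_one ε).smul _

lemma trace_perturb {n : Type*} [Fintype n] [DecidableEq n] {ρ : Matrix n n ℂ}
    (h : ρ.trace = 1) {ε : ℝ} (hε : 0 < ε) :
    (((1 + Fintype.card n * ε)⁻¹ : ℝ) • (ρ + (ε : ℂ) • 1) : Matrix n n ℂ).trace = 1 := by
  have h0 : ((1 + Fintype.card n * ε : ℝ) : ℂ) ≠ 0 := by
    exact_mod_cast (by positivity : (1 + Fintype.card n * ε : ℝ) ≠ 0)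
  rw [trace_smul, trace_add, h, trace_smul, trace_one, Complex.real_smul, Complex.ofReal_inv,
    smul_eq_mul, mul_comm (ε : ℂ)]
  rw [inv_mul_eq_one₀ h0]
  push_cast
  rfl

lemma posSemidef_perturb {n : Type*} [Fintype n] [DecidableEq n] {ρ : Matrix n n ℂ}
    (h : ρ.PosSemidef) {ε : ℝ} (hε : 0 < ε) :
    (((1 + Fintype.card n * ε)⁻¹ : ℝ) • (ρ + (ε : ℂ) • 1) : Matrix n n ℂ).PosSemidef := by
  refine PosSemidef.smul (h.add (PosSemidef.one.smul ?_)) (by positivity)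
  exact_mod_cast hε.le

lemma tendsto_perturb_trace {n : Type*} [Fintype n] [DecidableEq n] (ρ M : Matrix n n ℂ) :
    Tendsto (fun ε : ℝ => ((((1 + Fintype.card n * ε)⁻¹ : ℝ) •
      (ρ + (ε : ℂ) • 1) : Matrix n n ℂ) * M).trace) (𝓝[>] 0) (𝓝 (ρ * M).trace) := by
  have h1 : Tendsto (fun ε : ℝ => (1 + Fintype.card n * ε)⁻¹) (𝓝 0) (𝓝 1) := by
    have : Tendsto (fun ε : ℝ => 1 + Fintype.card n * ε) (𝓝 0) (𝓝 1) :=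
      Continuous.tendsto' (by fun_prop) _ _ (by simp)
    simpa using this.inv₀ one_ne_zero
  have h2 : Tendsto (fun ε : ℝ => ((ρ + (ε : ℂ) • 1) * M).trace) (𝓝 0) (𝓝 (ρ * M).trace) :=
    Continuous.tendsto' (by fun_prop) _ _ (by simp)
  have h3 := (h1.smul h2).mono_left (nhdsWithin_le_nhds (s := Set.Ioi 0))
  rw [one_smul] at h3
  refine h3.congr fun ε => ?_
  rw [Matrix.smul_mul, trace_smul]

/-- The mutual information dominates squared covariances of observables. -/
theorem covariance_sq_le_mutualInfo {ρ : Matrix (A × B) (A × B) ℂ} (h : ρ.PosSemidef)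
    (h1 : ρ.trace = 1) {MA : Matrix A A ℂ} {MB : Matrix B B ℂ}
    (hMA : MA.IsHermitian) (hMB : MB.IsHermitian)
    (hM : (1 - (MA ⊗ₖ MB) * (MA ⊗ₖ MB)).PosSemidef) :
    ((ρ * (MA ⊗ₖ MB)).trace - (ptraceB ρ * MA).trace * (ptraceA ρ * MB).trace).re ^ 2 / 2
      ≤ vN (ptraceB ρ) + vN (ptraceA ρ) - vN ρ := by
  have hA := posSemidef_ptraceB h
  have hB := posSemidef_ptraceA h
  have sA := IsSpecDecomp.of_isHermitian hA.isHermitian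
  have sB := IsSpecDecomp.of_isHermitian hB.isHermitian
  have hA1 := (trace_ptraceB ρ).trans h1
  have hB1 := (trace_ptraceA ρ).trans h1
  have hMM : (MA ⊗ₖ MB).IsHermitian := by
    rw [IsHermitian, conjTranspose_kronecker, hMA.eq, hMB.eq]
  set pA := hA.isHermitian.eigenvalues with hpA
  set pB := hB.isHermitian.eigenvalues with hpB
  have key : ∀ ε : ℝ, 0 < ε →
      ((ρ * (MA ⊗ₖ MB)).trace - ((((1 + Fintype.card A * ε)⁻¹ : ℝ) •
        (ptraceB ρ + (ε : ℂ) • 1) : Matrix A A ℂ) * MA).trace *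
        ((((1 + Fintype.card B * ε)⁻¹ : ℝ) •
        (ptraceA ρ + (ε : ℂ) • 1) : Matrix B B ℂ) * MB).trace).re ^ 2 / 2
      ≤ -vN ρ - (∑ a, pA a * Real.log ((1 + Fintype.card A * ε)⁻¹ * (pA a + ε))
          + ∑ b, pB b * Real.log ((1 + Fintype.card B * ε)⁻¹ * (pB b + ε))) := by
    intro ε hε
    have posA : ∀ a, 0 < (1 + Fintype.card A * ε)⁻¹ * (pA a + ε) := fun a => by
      have := hA.eigenvalues_nonneg a
      positivity
    have posB : ∀ b, 0 < (1 + Fintype.card B * ε)⁻¹ * (pB b + ε) := fun b => by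
      have := hB.eigenvalues_nonneg b
      positivity
    have sσ := (sA.perturb ε).kronecker (sB.perturb ε)
    have hp := pinsker (IsSpecDecomp.of_isHermitian h.isHermitian) sσ h
      ((posSemidef_perturb hA hε).kronecker (posSemidef_perturb hB hε)) h.eigenvalues_nonneg
      (fun x => mul_pos (posA x.1) (posB x.2)) h1
      (by rw [trace_kronecker, trace_perturb hA1 hε, trace_perturb hB1 hε, one_mul]) hMM hM
    rw [relEnt_eigen _ sσ, ← mul_kronecker_mul, trace_kronecker, ← Complex.sub_re] at hp
    refine hp.trans (le_of_eq ?_)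
    congr 1
    rw [← sum_diag_mul_fst sB.unitary' sA
        (fun a => Real.log ((1 + Fintype.card A * ε)⁻¹ * (pA a + ε))),
      ← sum_diag_mul_snd sA.unitary' sB
        (fun b => Real.log ((1 + Fintype.card B * ε)⁻¹ * (pB b + ε))), ← Finset.sum_add_distrib]
    refine Finset.sum_congr rfl fun x _ => ?_
    rw [Real.log_mul (posA x.1).ne' (posB x.2).ne', mul_add]
  have lim : ∀ (k : ℕ) (c : ℝ),
      Tendsto (fun ε : ℝ => (1 + k * ε)⁻¹ * (c + ε)) (𝓝[>] 0) (𝓝 c) := by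
    intro k c
    have t1 : Tendsto (fun ε : ℝ => 1 + k * ε) (𝓝 0) (𝓝 1) :=
      Continuous.tendsto' (by fun_prop) _ _ (by simp)
    have t2 : Tendsto (fun ε : ℝ => c + ε) (𝓝 0) (𝓝 c) :=
      Continuous.tendsto' (by fun_prop) _ _ (by simp)
    simpa using ((t1.inv₀ one_ne_zero).mul t2).mono_left (nhdsWithin_le_nhds (s := Set.Ioi 0))
  have lA := tendsto_sum_mul_log (q := pA) fun a => lim (Fintype.card A) (pA a)
  have lB := tendsto_sum_mul_log (q := pB) fun b => lim (Fintype.card B) (pB b)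
  have lC := ((Complex.continuous_re.tendsto _).comp (((tendsto_perturb_trace (ptraceB ρ) MA).mul
    (tendsto_perturb_trace (ptraceA ρ) MB)).const_sub (ρ * (MA ⊗ₖ MB)).trace))
  have hlim := le_of_tendsto_of_tendsto ((lC.pow 2).div_const 2) ((lA.add lB).const_sub (-vN ρ))
    (by filter_upwards [self_mem_nhdsWithin] with ε hε using key ε hε)
  rw [vN_eq_sum hA.isHermitian, vN_eq_sum hB.isHermitian]
  linarith

end MutualInformation

section PurityBound

/-- The Bregman divergence of `y ↦ y log y` at `1`. -/
noncomputable def klFun (y : ℝ) : ℝ := y * Real.log y - y + 1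

lemma hasDerivAt_klFun {y : ℝ} (hy : 0 < y) : HasDerivAt klFun (Real.log y) y := by
  have h := ((Real.hasDerivAt_mul_log hy.ne').sub (hasDerivAt_id y)).add_const 1
  refine h.congr_deriv ?_
  ring

lemma continuous_klFun : Continuous klFun :=
  (Real.continuous_mul_log.sub continuous_id).add continuous_const

lemma antitoneOn_klFun_sub_sq : AntitoneOn (fun y => klFun y - (y - 1) ^ 2 / 2) (Set.Ici 0) := by
  have hd : ∀ y : ℝ, 0 < y →
      HasDerivAt (fun y => klFun y - (y - 1) ^ 2 / 2) (Real.log y - (y - 1)) y := by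
    intro y hy
    have h := (hasDerivAt_klFun hy).sub ((((hasDerivAt_id y).sub_const 1).pow 2).div_const 2)
    refine h.congr_deriv ?_
    simp
  refine antitoneOn_of_deriv_nonpos (convex_Ici 0)
    (continuous_klFun.sub (by fun_prop)).continuousOn ?_ ?_
  · intro y hy
    rw [interior_Ici] at hy
    exact (hd y hy).differentiableAt.differentiableWithinAt
  · intro y hy
    rw [interior_Ici] at hy
    rw [(hd y hy).deriv]
    linarith [Real.log_le_sub_one_of_pos hy]

lemma two_mul_sub_one_le {y : ℝ} (hy : 1 ≤ y) : 2 * (y - 1) ≤ (y + 1) * Real.log y := by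
  have hd : ∀ y : ℝ, 1 ≤ y → HasDerivAt (fun y => (y + 1) * Real.log y - 2 * (y - 1))
      (Real.log y - (1 - y⁻¹)) y := by
    intro y hy
    have hy0 : 0 < y := by linarith
    have h := (((hasDerivAt_id y).add_const 1).mul (Real.hasDerivAt_log hy0.ne')).sub
      (((hasDerivAt_id y).sub_const 1).const_mul 2)
    refine h.congr_deriv ?_
    simp only [id]
    field_simp
    ring
  have hm : MonotoneOn (fun y => (y + 1) * Real.log y - 2 * (y - 1)) (Set.Ici 1) := by
    refine monotoneOn_of_deriv_nonneg (convex_Ici 1)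
      (fun y hy => (hd y hy).continuousAt.continuousWithinAt)
      (fun y hy => (hd y (interior_subset hy)).differentiableAt.differentiableWithinAt) ?_
    intro y hy
    have hy1 : (1 : ℝ) ≤ y := interior_subset hy
    rw [(hd y hy1).deriv]
    linarith [Real.one_sub_inv_le_log_of_pos (by linarith : 0 < y)]
  have := hm Set.self_mem_Ici hy hy
  simp at this
  linarith

lemma antitoneOn_klFun_div_sq : AntitoneOn (fun y => klFun y / (y - 1) ^ 2) (Set.Ioi 1) := by
  have hd : ∀ y ∈ Set.Ioi (1 : ℝ), HasDerivAt (fun y => klFun y / (y - 1) ^ 2)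
      ((2 * (y - 1) - (y + 1) * Real.log y) / (y - 1) ^ 3) y := by
    intro y hy
    have hy1 : 0 < y - 1 := sub_pos.mpr hy
    have h := (hasDerivAt_klFun (by linarith : 0 < y)).div (((hasDerivAt_id y).sub_const 1).pow 2)
      (pow_pos hy1 2).ne'
    refine h.congr_deriv ?_
    simp only [id, Pi.pow_apply, klFun]
    field_simp
    ring
  refine antitoneOn_of_deriv_nonpos (convex_Ioi 1)
    (fun y hy => (hd y hy).continuousAt.continuousWithinAt)
    (fun y hy => (hd y (interior_subset hy)).differentiableAt.differentiableWithinAt) ?_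
  intro y hy
  have hy1 : (1 : ℝ) < y := interior_subset hy
  rw [(hd y hy1).deriv]
  refine div_nonpos_of_nonpos_of_nonneg ?_ (pow_nonneg (by linarith) 3)
  linarith [two_mul_sub_one_le hy1.le]

lemma klFun_mul_sq_le {y Y : ℝ} (hy : 0 ≤ y) (hyY : y ≤ Y) (hY : 1 < Y) :
    klFun Y * (y - 1) ^ 2 ≤ klFun y * (Y - 1) ^ 2 := by
  have hY0 : 0 < (Y - 1) ^ 2 := pow_pos (by linarith) 2
  rcases le_or_gt y 1 with h | h
  · have h1 := antitoneOn_klFun_sub_sq (Set.mem_Ici.mpr hy) (Set.mem_Ici.mpr zero_le_one) h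
    have h2 := antitoneOn_klFun_sub_sq (Set.mem_Ici.mpr zero_le_one)
      (Set.mem_Ici.mpr (by linarith : (0 : ℝ) ≤ Y)) hY.le
    simp only [klFun, Real.log_one] at h1 h2 ⊢
    nlinarith [sq_nonneg (y - 1)]
  · have hy0 : 0 < (y - 1) ^ 2 := pow_pos (by linarith) 2
    have := antitoneOn_klFun_div_sq h hY hyY
    exact (div_le_div_iff₀ hY0 hy0).mp this

lemma mul_klFun_div {s x : ℝ} (hs : 0 < s) (hx : 0 ≤ x) :
    s * klFun (x / s) = x * Real.log x - s * Real.log s - (Real.log s + 1) * (x - s) := by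
  rcases hx.eq_or_lt with rfl | hx
  · simp [klFun]
    ring
  · rw [klFun, Real.log_div hx.ne' hs.ne']
    field_simp
    ring

/-- The quadratic touching `x log x` to first order at `s` and agreeing with it at `L` is a lower
bound on `[0, L]`. -/
lemma quadratic_le_mul_log {s L x : ℝ} (hs : 0 < s) (hsL : s ≤ L) (hx : 0 ≤ x) (hxL : x ≤ L) :
    s * Real.log s + (Real.log s + 1) * (x - s)
      + (L * Real.log L - s * Real.log s - (Real.log s + 1) * (L - s)) / (L - s) ^ 2 * (x - s) ^ 2
      ≤ x * Real.log x := by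
  rw [← mul_klFun_div hs (by linarith)]
  suffices h : s * klFun (L / s) / (L - s) ^ 2 * (x - s) ^ 2 ≤ s * klFun (x / s) by
    rw [mul_klFun_div hs hx] at h
    linarith
  rcases hsL.eq_or_lt with rfl | hsL
  · have h := antitoneOn_klFun_sub_sq (Set.mem_Ici.mpr (div_nonneg hx hs.le))
      (Set.mem_Ici.mpr zero_le_one) ((div_le_one hs).mpr hxL)
    have h0 : 0 ≤ klFun (x / s) := by
      simp only [klFun, Real.log_one] at h ⊢
      nlinarith [sq_nonneg (x / s - 1)]
    simpa using mul_nonneg hs.le h0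
  · have h := klFun_mul_sq_le (div_nonneg hx hs.le) (div_le_div_of_nonneg_right hxL hs.le)
      ((one_lt_div hs).mpr hsL)
    have e1 : (x / s - 1) ^ 2 = (x - s) ^ 2 / s ^ 2 := by field_simp
    have e2 : (L / s - 1) ^ 2 = (L - s) ^ 2 / s ^ 2 := by field_simp
    rw [e1, e2, ← mul_div_assoc, ← mul_div_assoc, div_le_div_iff_of_pos_right (by positivity)] at h
    have hL : 0 < (L - s) ^ 2 := pow_pos (by linarith) 2
    rw [div_mul_eq_mul_div, div_le_iff₀ hL]
    nlinarith

/-- Among probability vectors of given purity, the entropy is at most `Uent`. -/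
theorem neg_sum_mul_log_le_Uent {n : Type*} [Fintype n] [DecidableEq n] {p : n → ℝ} {P : ℝ} {d : ℕ}
    (hd : Fintype.card n = d) (hd2 : 2 ≤ d) (hp : ∀ i, 0 ≤ p i) (h1 : ∑ i, p i = 1)
    (hP : ∑ i, p i ^ 2 = P) : -∑ i, p i * Real.log (p i) ≤ Uent P d := by
  have hD : (2 : ℝ) ≤ d := by exact_mod_cast hd2
  have hmax : ∀ i, (p i - 1 / d) ^ 2 ≤ (1 - 1 / d) * (P - 1 / (d : ℝ)) := by
    intro i
    have hs1 : p i + ∑ j ∈ Finset.univ.erase i, p j = 1 := by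
      rw [Finset.add_sum_erase _ _ (Finset.mem_univ i), h1]
    have hs2 : p i ^ 2 + ∑ j ∈ Finset.univ.erase i, p j ^ 2 = P := by
      rw [Finset.add_sum_erase _ (fun j => p j ^ 2) (Finset.mem_univ i), hP]
    have hcs := sq_sum_le_card_mul_sum_sq (s := Finset.univ.erase i) (f := p)
    rw [Finset.card_erase_of_mem (Finset.mem_univ i), Finset.card_univ, hd,
      Nat.cast_sub (by omega), Nat.cast_one, eq_sub_of_add_eq' hs1, eq_sub_of_add_eq' hs2] at hcs
    have hd0 : (0 : ℝ) < d := by linarith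
    have e1 : (p i - 1 / d) ^ 2 = (d * (d * p i ^ 2 - 2 * p i) + 1) / (d : ℝ) ^ 2 := by
      field_simp
      ring
    have e2 : (1 - 1 / d) * (P - 1 / (d : ℝ)) = (d - 1) * (d * P - 1) / (d : ℝ) ^ 2 := by
      field_simp
    rw [e1, e2, div_le_div_iff_of_pos_right (by positivity)]
    nlinarith
  obtain ⟨i₀⟩ : Nonempty n := Fintype.card_pos_iff.mp (by omega)
  have hR0 : 0 ≤ (1 - 1 / d) * (P - 1 / (d : ℝ)) := (sq_nonneg _).trans (hmax i₀)
  have hR := Real.sq_sqrt hR0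
  have hRn := Real.sqrt_nonneg ((1 - 1 / d) * (P - 1 / (d : ℝ)))
  have hpL : ∀ i, p i ≤ 1 / d + √((1 - 1 / d) * (P - 1 / (d : ℝ))) := by
    intro i
    have := Real.le_sqrt_of_sq_le (hmax i)
    linarith
  rw [Uent]
  set R := √((1 - 1 / d) * (P - 1 / (d : ℝ))) with hRdef
  set L := 1 / (d : ℝ) + R with hL
  obtain ⟨s, hs⟩ : ∃ s, s = (1 - L) / ((d : ℝ) - 1) := ⟨_, rfl⟩
  rw [← hs]
  have hsum : ((d : ℝ) - 1) * s = 1 - L := by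
    rw [hs]
    field_simp [(by linarith : (d : ℝ) - 1 ≠ 0)]
  have hsq : ((d : ℝ) - 1) * s ^ 2 = P - L ^ 2 := by
    have hRL : (L - 1 / d) ^ 2 = (1 - 1 / d) * (P - 1 / (d : ℝ)) := by
      rw [← hR, hL]
      ring
    have hd1 : (d : ℝ) - 1 ≠ 0 := by linarith
    have hd0 : (d : ℝ) ≠ 0 := by linarith
    have h2 : (1 - L) ^ 2 = ((d : ℝ) - 1) * (P - L ^ 2) := by
      field_simp at hRL
      have : (d : ℝ) * ((1 - L) ^ 2 - ((d : ℝ) - 1) * (P - L ^ 2)) = 0 := by linear_combination hRL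
      have := (mul_eq_zero.mp this).resolve_left hd0
      linarith
    rw [hs, div_pow, h2]
    field_simp
  have hP1 : P ≤ 1 := by
    rw [← hP, ← h1]
    refine Finset.sum_le_sum fun i _ => ?_
    have : p i ≤ 1 := h1 ▸ Finset.single_le_sum (fun j _ => hp j) (Finset.mem_univ i)
    nlinarith [hp i]
  have hL1 : L ≤ 1 := by
    have : R ≤ 1 - 1 / d := by
      have hd' : 1 / (d : ℝ) ≤ 1 := by
        rw [div_le_one (by linarith)]
        linarith
      refine Real.sqrt_le_iff.mpr ⟨by linarith, ?_⟩
      nlinarith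
    linarith
  have hs0 : 0 ≤ s := by
    rw [hs]
    exact div_nonneg (by linarith) (by linarith)
  have hsL : s ≤ L := by
    have : 1 ≤ d * L := by
      rw [hL, mul_add, mul_one_div_cancel (by linarith)]
      nlinarith
    nlinarith
  rw [← hsum]
  rcases hs0.eq_or_lt with h0 | h0
  · have hLeq : L = 1 := by
      rw [← h0] at hsum
      linarith
    have hPeq : P = 1 := by
      rw [← h0, hLeq] at hsq
      linarith
    have hz : ∀ i, p i - p i ^ 2 = 0 := by
      have hsum0 : ∑ i, (p i - p i ^ 2) = 0 := by
        rw [Finset.sum_sub_distrib, h1, hP, hPeq, sub_self]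
      have hnn : ∀ i ∈ Finset.univ, 0 ≤ p i - p i ^ 2 := fun i _ => by
        have := hpL i
        rw [hLeq] at this
        nlinarith [hp i]
      exact fun i => (Finset.sum_eq_zero_iff_of_nonneg hnn).mp hsum0 i (Finset.mem_univ i)
    have hlog : ∀ i, p i * Real.log (p i) = 0 := by
      intro i
      have : p i * (1 - p i) = 0 := by linarith [hz i]
      rcases mul_eq_zero.mp this with h | h
      · simp [h]
      · simp [(by linarith : p i = 1)]
    simp [hlog, ← h0, hLeq]
  · have hq := Finset.sum_le_sum fun i (_ : i ∈ Finset.univ) =>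
      quadratic_le_mul_log h0 hsL (hp i) (hpL i)
    set κ := (L * Real.log L - s * Real.log s - (Real.log s + 1) * (L - s)) / (L - s) ^ 2 with hκ
    have e1 : ∑ i, (p i - s) = L - s := by
      rw [Finset.sum_sub_distrib, h1, Finset.sum_const, Finset.card_univ, hd, nsmul_eq_mul]
      linarith
    have e2 : ∑ i, (p i - s) ^ 2 = (L - s) ^ 2 := by
      have : ∀ i, (p i - s) ^ 2 = p i ^ 2 - 2 * s * p i + s ^ 2 := fun i => by ring
      simp only [this, Finset.sum_add_distrib, Finset.sum_sub_distrib, ← Finset.mul_sum, hP, h1,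
        Finset.sum_const, Finset.card_univ, hd, nsmul_eq_mul]
      linear_combination 2 * s * hsum - hsq
    rw [Finset.sum_add_distrib, Finset.sum_add_distrib, Finset.sum_const, Finset.card_univ, hd,
      nsmul_eq_mul, ← Finset.mul_sum, ← Finset.mul_sum, e1, e2] at hq
    have e3 : κ * (L - s) ^ 2
        = L * Real.log L - s * Real.log s - (Real.log s + 1) * (L - s) := by
      rcases hsL.eq_or_lt with h | h
      · simp [← h]
      · rw [hκ, div_mul_cancel₀ _ (pow_pos (by linarith) 2).ne']
    linarith

end PurityBound

section OperatorNorm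

variable {n m : Type*} [Fintype n] [DecidableEq n] [Fintype m] [DecidableEq m]

open scoped Matrix.Norms.L2Operator MatrixOrder in
lemma posSemidef_opNorm_sq_sub {M : Matrix n n ℂ} (hM : M.IsHermitian) :
    ((opNorm M ^ 2) • (1 : Matrix n n ℂ) - M * M).PosSemidef := by
  have h := CStarAlgebra.star_mul_le_algebraMap_norm_sq (a := M)
  rw [Matrix.le_iff, star_eq_conjTranspose, hM.eq, Algebra.algebraMap_eq_smul_one] at h
  exact h

lemma posSemidef_one_sub_sq {M : Matrix n n ℂ} (hM : M.IsHermitian) (h0 : opNorm M ≠ 0) :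
    (1 - ((opNorm M)⁻¹ • M) * ((opNorm M)⁻¹ • M)).PosSemidef := by
  have h := (posSemidef_opNorm_sq_sub hM).smul (sq_nonneg (opNorm M)⁻¹)
  convert h using 1
  rw [smul_sub, smul_smul, ← mul_pow, inv_mul_cancel₀ h0, one_pow, one_smul, Matrix.smul_mul,
    Matrix.mul_smul, smul_smul, sq]

lemma posSemidef_one_sub_kronecker_sq {M : Matrix m m ℂ} {N : Matrix n n ℂ}
    (hM : M.IsHermitian) (hM1 : (1 - M * M).PosSemidef) (hN1 : (1 - N * N).PosSemidef) :
    (1 - (M ⊗ₖ N) * (M ⊗ₖ N)).PosSemidef := by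
  have hMM : (M * M).PosSemidef := by
    have := posSemidef_conjTranspose_mul_self M
    rwa [hM.eq] at this
  have h := (hM1.kronecker (PosSemidef.one (n := n))).add (hMM.kronecker hN1)
  have e : 1 - (M ⊗ₖ N) * (M ⊗ₖ N) = (1 - M * M) ⊗ₖ 1 + (M * M) ⊗ₖ (1 - N * N) := by
    rw [← mul_kronecker_mul, ← one_kronecker_one]
    ext x y
    simp only [Matrix.sub_apply, Matrix.add_apply, kroneckerMap_apply]
    ring
  rw [e]
  exact h

end OperatorNorm

section

variable {A B C : Type*} [Fintype A] [DecidableEq A] [Fintype B] [DecidableEq B] [Fintype C]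
  [DecidableEq C]

/-- The entropy of a density matrix is bounded in terms of its purity and dimension. -/
theorem vN_le_Uent {n : Type*} [Fintype n] [DecidableEq n] {ρ : Matrix n n ℂ} {P : ℝ} {d : ℕ}
    (hd : Fintype.card n = d) (hd2 : 2 ≤ d) (h : ρ.PosSemidef) (h1 : ρ.trace = 1)
    (hP : (ρ * ρ).trace = (P : ℂ)) : vN ρ ≤ Uent P d := by
  have hs := IsSpecDecomp.of_isHermitian h.isHermitian
  rw [vN_eq_sum h.isHermitian]
  refine neg_sum_mul_log_le_Uent hd hd2 h.eigenvalues_nonneg ?_ ?_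
  · have := hs.trace_eq.symm.trans h1
    exact_mod_cast this
  · have hs2 : IsSpecDecomp (ρ * ρ) (h.isHermitian.eigenvectorUnitary : Matrix n n ℂ)
        (fun i => h.isHermitian.eigenvalues i ^ 2) := by
      refine ⟨hs.unitary, ?_⟩
      generalize (h.isHermitian.eigenvectorUnitary : Matrix n n ℂ) = U at hs ⊢
      have e : diagonal (fun i => ((h.isHermitian.eigenvalues i ^ 2 : ℝ) : ℂ))
          = Uᴴ * ρ * U * (Uᴴ * ρ * U) := by
        rw [hs.conj_eq, diagonal_mul_diagonal]
        simp [sq]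
      rw [e]
      calc ρ * ρ = (U * Uᴴ) * ρ * (U * Uᴴ) * ρ * (U * Uᴴ) := by simp [hs.unitary']
        _ = _ := by simp only [Matrix.mul_assoc]
    have := hs2.trace_eq.symm.trans hP
    exact_mod_cast this

lemma condMutualInfo_nonneg [Nonempty B] {ρ : Matrix (A × B × C) (A × B × C) ℂ}
    (h : ρ.PosSemidef) : 0 ≤ condMutualInfo ρ := by
  have := strong_subadditivity h
  rw [condMutualInfo]
  linarith

lemma exists_extension {ρ : Matrix (A × B) (A × B) ℂ} (h : ρ.PosSemidef) (h1 : ρ.trace = 1) :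
    ∃ σ : Matrix (A × B × Fin 1) (A × B × Fin 1) ℂ,
      σ.PosSemidef ∧ σ.trace = 1 ∧ ptraceC3 σ = ρ := by
  refine ⟨ρ.submatrix (fun x => (x.1, x.2.1)) (fun x => (x.1, x.2.1)), h.submatrix _, ?_, ?_⟩
  · rw [← h1]
    simp [trace, Fintype.sum_prod_type]
  · ext x y
    simp [ptraceC3]

/-- The squashed entanglement inherits every lower bound valid for all extensions. -/
lemma le_Esq {ρ : Matrix (A × B) (A × B) ℂ} (h : ρ.PosSemidef) (h1 : ρ.trace = 1) {b : ℝ}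
    (hb : ∀ (d : ℕ), 1 ≤ d → ∀ σ : Matrix (A × B × Fin d) (A × B × Fin d) ℂ,
      σ.PosSemidef → ptraceC3 σ = ρ → 2 * b ≤ condMutualInfo σ) : b ≤ Esq ρ := by
  obtain ⟨σ, hσ, hσ1, hσρ⟩ := exists_extension h h1
  refine le_csInf ⟨_, 1, le_rfl, σ, hσ, hσ1, hσρ, rfl⟩ ?_
  rintro x ⟨d, hd, τ, hτ, -, hτρ, rfl⟩
  linarith [hb d hd τ hτ hτρ]

lemma isHermitian_real_smul {M : Matrix A A ℂ} (hM : M.IsHermitian) (c : ℝ) :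
    (c • M).IsHermitian := by
  rw [Matrix.IsHermitian, conjTranspose_smul, hM.eq, star_trivial]

/-- The mutual information dominates the squared covariance of observables, normalized by
their operator norms. -/
theorem normalized_covariance_sq_le_mutualInfo {ρ : Matrix (A × B) (A × B) ℂ}
    (h : ρ.PosSemidef) (h1 : ρ.trace = 1) {MA : Matrix A A ℂ} {MB : Matrix B B ℂ}
    (hMA : MA.IsHermitian) (hMB : MB.IsHermitian) (hA0 : opNorm MA ≠ 0) (hB0 : opNorm MB ≠ 0) :
    ((ρ * (MA ⊗ₖ MB)).trace - (ptraceB ρ * MA).trace * (ptraceA ρ * MB).trace).re ^ 2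
        / (2 * opNorm MA ^ 2 * opNorm MB ^ 2)
      ≤ vN (ptraceB ρ) + vN (ptraceA ρ) - vN ρ := by
  have hA := isHermitian_real_smul hMA (opNorm MA)⁻¹
  have hB := isHermitian_real_smul hMB (opNorm MB)⁻¹
  have key := covariance_sq_le_mutualInfo h h1 hA hB
    (posSemidef_one_sub_kronecker_sq hA (posSemidef_one_sub_sq hMA hA0)
      (posSemidef_one_sub_sq hMB hB0))
  refine le_trans (le_of_eq ?_) key
  rw [smul_kronecker, kronecker_smul, smul_smul, Matrix.mul_smul, Matrix.mul_smul,
    Matrix.mul_smul, trace_smul, trace_smul, trace_smul, smul_mul_smul_comm, ← smul_sub,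
    Complex.smul_re, smul_eq_mul]
  field_simp

end

end Squashed

open Squashed

/-- Theorem 2: for any density matrix `ρ_AB` with global purity
`P_AB` and Hermitian observables `M_A, M_B` with nonzero operator norm,
`E_sq(ρ_AB) ≥ max{C(M_A,M_B)²/(4‖M_A‖²‖M_B‖²) − U(P_AB, d_A d_B)/2, 0}`. -/
theorem squashed_entanglement_covariance_lower_bound
    (dA dB : ℕ) (hdA : 2 ≤ dA) (hdB : 2 ≤ dB)
    (ρAB : Matrix (Fin dA × Fin dB) (Fin dA × Fin dB) ℂ)
    (hρ : ρAB.PosSemidef) (htr : ρAB.trace = 1)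
    (PAB : ℝ) (hPAB : (ρAB * ρAB).trace = (PAB : ℂ))
    (MA : Matrix (Fin dA) (Fin dA) ℂ) (MB : Matrix (Fin dB) (Fin dB) ℂ)
    (hMA : MA.IsHermitian) (hMB : MB.IsHermitian)
    (hMAnorm : opNorm MA ≠ 0) (hMBnorm : opNorm MB ≠ 0)
    (Cval : ℝ)
    (hC : (Cval : ℂ) = (ρAB * (MA ⊗ₖ MB)).trace
        - (ρAB * (MA ⊗ₖ (1 : Matrix (Fin dB) (Fin dB) ℂ))).trace
          * (ρAB * ((1 : Matrix (Fin dA) (Fin dA) ℂ) ⊗ₖ MB)).trace) :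
    Esq ρAB ≥
      max (Cval ^ 2 / (4 * opNorm MA ^ 2 * opNorm MB ^ 2) - Uent PAB (dA * dB) / 2) 0 := by
  have : Nonempty (Fin dA) := ⟨⟨0, by omega⟩⟩
  have : Nonempty (Fin dB) := ⟨⟨0, by omega⟩⟩
  have hU : vN ρAB ≤ Uent PAB (dA * dB) :=
    vN_le_Uent (by simp) (by nlinarith) hρ htr hPAB
  have hI := normalized_covariance_sq_le_mutualInfo hρ htr hMA hMB hMAnorm hMBnorm
  rw [← trace_mul_kronecker_one, ← trace_mul_one_kronecker, ← hC, Complex.ofReal_re] at hI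
  have hhalf : Cval ^ 2 / (4 * opNorm MA ^ 2 * opNorm MB ^ 2)
      = Cval ^ 2 / (2 * opNorm MA ^ 2 * opNorm MB ^ 2) / 2 := by
    rw [div_div]
    ring_nf
  refine le_Esq hρ htr fun dC hdC σ hσ hσρ => ?_
  have : Nonempty (Fin dC) := ⟨⟨0, by omega⟩⟩
  have hcond := le_condMutualInfo hσ
  rw [hσρ] at hcond
  rcases max_choice
    (Cval ^ 2 / (4 * opNorm MA ^ 2 * opNorm MB ^ 2) - Uent PAB (dA * dB) / 2) 0 with h | h
  · rw [h, hhalf]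
    linarith
  · rw [h, mul_zero]
    exact condMutualInfo_nonneg hσ
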